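/- Let M, N ∈ ⋀X be nonzero with osp M ∩ osp N = {0}. Then M∧N ≠ 0, osp(M∧N) = osp M ⊕ osp N, and isp(M∧N) = isp M ⊕ isp N. -/

import Mathlib

open scoped RealInnerProductSpace

/-- The blade `v₁ ∧ ⋯ ∧ v_k` in the exterior algebra. -/
noncomputable def expBlade {X : Type*} [AddCommGroup X] [Module ℝ X] {k : ℕ}
    (v : Fin k → X) : ExteriorAlgebra ℝ X :=
  (List.ofFn fun i => ExteriorAlgebra.ι ℝ (v i)).prod

/-- The inner space of a multivector `M`: the subspace `{v ∈ X : v ∧ M = 0}`. -/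
noncomputable def innerSpace {X : Type*} [AddCommGroup X] [Module ℝ X]
    (M : ExteriorAlgebra ℝ X) : Submodule ℝ X :=
  LinearMap.ker ((LinearMap.mulRight ℝ M).comp (ExteriorAlgebra.ι ℝ))

/-- The outer space of a multivector `M`: the intersection of all subspaces `V ⊆ X` such
that `M` lies in the subalgebra of the exterior algebra generated by `V`. -/
noncomputable def outerSpace {X : Type*} [AddCommGroup X] [Module ℝ X]
    (M : ExteriorAlgebra ℝ X) : Submodule ℝ X :=
  sInf {V : Submodule ℝ X |
    M ∈ Algebra.adjoin ℝ (⇑(ExteriorAlgebra.ι ℝ (M := X)) '' (V : Set X))}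

noncomputable section

open CliffordAlgebra Module

namespace ExteriorAlgebra

variable {X : Type*} [AddCommGroup X] [Module ℝ X]

/-- The functionals `φ` whose contraction with `M` vanishes. -/
def contractKer (M : ExteriorAlgebra ℝ X) : Submodule ℝ (Dual ℝ X) :=
  LinearMap.ker ((contractLeft (Q := (0 : QuadraticForm ℝ X))).flip M)

lemma mem_contractKer {M : ExteriorAlgebra ℝ X} {φ : Dual ℝ X} :
    φ ∈ contractKer M ↔ contractLeft φ M = 0 := Iff.rfl

lemma mem_innerSpace {M : ExteriorAlgebra ℝ X} {v : X} :
    v ∈ innerSpace M ↔ ι ℝ v * M = 0 := Iff.rfl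

lemma contractLeft_ι_mul_eq (φ : Dual ℝ X) (x : X) (M : ExteriorAlgebra ℝ X) :
    contractLeft φ (ι ℝ x * M) = φ x • M - ι ℝ x * contractLeft φ M :=
  contractLeft_ι_mul (Q := 0) φ x M

lemma involute_ι_eq (x : X) :
    involute (Q := (0 : QuadraticForm ℝ X)) (ι ℝ x) = -ι ℝ x :=
  involute_ι x

lemma ι_mul_ι_eq_neg (x y : X) : ι ℝ x * ι ℝ y = -(ι ℝ y * ι ℝ x) :=
  eq_neg_of_add_eq_zero_left (ι_add_mul_swap x y)

lemma induction_ι_mul {C : ExteriorAlgebra ℝ X → Prop}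
    (algebraMap : ∀ r, C (algebraMap ℝ _ r)) (add : ∀ a b, C a → C b → C (a + b))
    (ι_mul : ∀ x a, C a → C (ι ℝ x * a)) (M : ExteriorAlgebra ℝ X) : C M :=
  CliffordAlgebra.left_induction (Q := (0 : QuadraticForm ℝ X)) algebraMap add
    (fun a x h => ι_mul x a h) M

lemma contractLeft_mul (φ : Dual ℝ X) (M N : ExteriorAlgebra ℝ X) :
    contractLeft φ (M * N) = contractLeft φ M * N + involute M * contractLeft φ N := by
  induction M using induction_ι_mul with
  | algebraMap r => simp [Algebra.algebraMap_eq_smul_one]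
  | add a b ha hb => simp only [add_mul, map_add, ha, hb]; abel
  | ι_mul x a h =>
    simp only [mul_assoc, contractLeft_ι_mul_eq, h, map_mul, involute_ι_eq]
    simp only [sub_mul, mul_add, smul_mul_assoc, mul_assoc, neg_mul]
    abel

lemma ι_mul_eq_involute_mul_ι (x : X) (M : ExteriorAlgebra ℝ X) :
    ι ℝ x * M = involute M * ι ℝ x := by
  induction M using induction_ι_mul with
  | algebraMap r => simp [Algebra.algebraMap_eq_smul_one]
  | add a b ha hb => simp only [add_mul, mul_add, map_add, ha, hb]
  | ι_mul y a h =>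
    rw [← mul_assoc, ι_mul_ι_eq_neg, neg_mul, mul_assoc, h, map_mul, involute_ι_eq]
    simp only [neg_mul, mul_assoc]

lemma involute_eq_zero_iff {M : ExteriorAlgebra ℝ X} :
    involute (Q := (0 : QuadraticForm ℝ X)) M = 0 ↔ M = 0 := by
  refine ⟨fun h => ?_, fun h => by rw [h, map_zero]⟩
  rw [← involute_involute (Q := (0 : QuadraticForm ℝ X)) M, h, map_zero]

lemma contractLeft_involute (φ : Dual ℝ X) (M : ExteriorAlgebra ℝ X) :
    contractLeft φ (involute M) = -involute (contractLeft φ M) := by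
  induction M using induction_ι_mul with
  | algebraMap r => simp [Algebra.algebraMap_eq_smul_one]
  | add a b ha hb => simp only [map_add, ha, hb]; abel
  | ι_mul y a h =>
    simp only [map_mul, involute_ι_eq, neg_mul, map_neg, contractLeft_ι_mul_eq, h, map_sub,
      map_smul, mul_neg]

lemma contractKer_le_contractKer_involute (M : ExteriorAlgebra ℝ X) :
    contractKer M ≤ contractKer (involute M) := fun φ hφ => by
  rw [mem_contractKer] at *
  rw [contractLeft_involute, hφ, map_zero, neg_zero]

lemma contractKer_le_contractKer_contractLeft (φ : Dual ℝ X) (M : ExteriorAlgebra ℝ X) :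
    contractKer M ≤ contractKer (contractLeft φ M) := fun ψ hψ => by
  rw [mem_contractKer] at *
  rw [contractLeft_comm, hψ, map_zero, neg_zero]

lemma contractKer_le_contractKer_ι_mul {M : ExteriorAlgebra ℝ X} {v : X}
    (hv : v ∈ (contractKer M).dualCoannihilator) :
    contractKer M ≤ contractKer (ι ℝ v * M) := fun φ hφ => by
  have h : φ v = 0 := (Submodule.mem_dualCoannihilator v).1 hv φ hφ
  rw [mem_contractKer] at *
  rw [contractLeft_ι_mul_eq, hφ, h, zero_smul, mul_zero, sub_zero]

lemma innerSpace_le_dualCoannihilator {M : ExteriorAlgebra ℝ X} (hM : M ≠ 0) :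
    innerSpace M ≤ (contractKer M).dualCoannihilator := fun v hv => by
  refine (Submodule.mem_dualCoannihilator v).2 fun φ hφ => ?_
  have h := contractLeft_ι_mul_eq φ v M
  rw [mem_innerSpace.1 hv, mem_contractKer.1 hφ, map_zero, mul_zero, sub_zero] at h
  exact (smul_eq_zero.1 h.symm).resolve_right hM

/-- The projection of `X` onto `ker φ` along `v`, when `φ v = 1`. -/
def projAlong (φ : Dual ℝ X) (v : X) : X →ₗ[ℝ] X := LinearMap.id - φ.smulRight v

lemma map_projAlong_add (φ : Dual ℝ X) (v : X) (M : ExteriorAlgebra ℝ X) :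
    map (projAlong φ v) M + ι ℝ v * contractLeft φ M = M := by
  induction M using induction_ι_mul with
  | algebraMap r => simp [Algebra.algebraMap_eq_smul_one]
  | add a b ha hb =>
    simp only [map_add, mul_add]
    nth_rewrite 3 [← ha]
    nth_rewrite 3 [← hb]
    abel
  | ι_mul x a h =>
    have hv (b : ExteriorAlgebra ℝ X) : ι ℝ v * (ι ℝ v * b) = 0 := by
      rw [← mul_assoc, ι_sq_zero, zero_mul]
    have hx (b : ExteriorAlgebra ℝ X) : ι ℝ x * (ι ℝ v * b) = -(ι ℝ v * (ι ℝ x * b)) := by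
      rw [← mul_assoc, ι_mul_ι_eq_neg, neg_mul, mul_assoc]
    rw [map_mul, map_apply_ι, contractLeft_ι_mul_eq, eq_sub_of_add_eq h]
    simp [projAlong, sub_mul, mul_sub, hv, hx]

lemma contractLeft_eq_zero_of_mem_adjoin {V : Submodule ℝ X} {M : ExteriorAlgebra ℝ X}
    (hM : M ∈ Algebra.adjoin ℝ (ι ℝ '' (V : Set X))) {φ : Dual ℝ X}
    (hφ : φ ∈ V.dualAnnihilator) : contractLeft φ M = 0 := by
  induction hM using Algebra.adjoin_induction with
  | mem x hx =>
    obtain ⟨v, hv, rfl⟩ := hx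
    have h : contractLeft (Q := (0 : QuadraticForm ℝ X)) φ (ι ℝ v) = algebraMap ℝ _ (φ v) :=
      contractLeft_ι (Q := 0) φ v
    rw [h, (Submodule.mem_dualAnnihilator φ).1 hφ v hv, map_zero]
  | algebraMap r => exact contractLeft_algebraMap (Q := 0) φ r
  | add x y _ _ hx hy => rw [map_add, hx, hy, add_zero]
  | mul x y _ _ hx hy => rw [contractLeft_mul, hx, hy, zero_mul, mul_zero, add_zero]

variable [FiniteDimensional ℝ X]

lemma mem_adjoin_dualCoannihilator (M : ExteriorAlgebra ℝ X) :
    M ∈ Algebra.adjoin ℝ (ι ℝ '' ((contractKer M).dualCoannihilator : Set X)) := by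
  suffices h : ∀ W : Submodule ℝ X, M ∈ Algebra.adjoin ℝ (ι ℝ '' (W : Set X)) →
      M ∈ Algebra.adjoin ℝ (ι ℝ '' ((contractKer M).dualCoannihilator : Set X)) by
    refine h ⊤ ?_
    have htop := CliffordAlgebra.adjoin_range_ι (Q := (0 : QuadraticForm ℝ X))
    rw [Submodule.top_coe, Set.image_univ]
    exact htop.ge trivial
  intro W
  induction W using WellFoundedLT.induction with
  | ind W ih =>
    intro hW
    by_cases hle : W ≤ (contractKer M).dualCoannihilator
    · exact Algebra.adjoin_mono (Set.image_mono hle) hW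
    obtain ⟨w, hw, hw'⟩ := SetLike.not_le_iff_exists.1 hle
    rw [Submodule.mem_dualCoannihilator] at hw'
    push Not at hw'
    obtain ⟨φ, hφ, hφw⟩ := hw'
    have hlt : W ⊓ LinearMap.ker φ < W :=
      lt_of_le_of_ne inf_le_left fun h => hφw (h.ge hw).2
    refine ih _ hlt ?_
    have h := map_projAlong_add φ ((φ w)⁻¹ • w) M
    rw [mem_contractKer.1 hφ, mul_zero, add_zero] at h
    have hmem := Subalgebra.mem_map.2 ⟨M, hW, h⟩
    rw [AlgHom.map_adjoin] at hmem
    refine Algebra.adjoin_mono ?_ hmem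
    rintro _ ⟨_, ⟨x, hx, rfl⟩, rfl⟩
    refine ⟨projAlong φ ((φ w)⁻¹ • w) x, ⟨?_, ?_⟩, (map_apply_ι _ _).symm⟩
    · exact W.sub_mem hx (W.smul_mem _ (W.smul_mem _ hw))
    · simp [projAlong, hφw]

lemma outerSpace_eq_dualCoannihilator (M : ExteriorAlgebra ℝ X) :
    outerSpace M = (contractKer M).dualCoannihilator := by
  refine le_antisymm (sInf_le (mem_adjoin_dualCoannihilator M)) (le_sInf fun V hV => ?_)
  have hle : V.dualAnnihilator ≤ contractKer M := fun φ hφ =>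
    contractLeft_eq_zero_of_mem_adjoin hV hφ
  exact (Submodule.dualCoannihilator_anti hle).trans
    Subspace.dualAnnihilator_dualCoannihilator_eq.le

lemma exists_eq_algebraMap_of_contractKer_eq_top {M : ExteriorAlgebra ℝ X}
    (h : contractKer M = ⊤) : ∃ r : ℝ, M = algebraMap ℝ _ r := by
  have hM := mem_adjoin_dualCoannihilator M
  rw [h, Submodule.dualCoannihilator_top, Submodule.bot_coe, Set.image_singleton, map_zero,
    Algebra.adjoin_singleton_zero, Algebra.mem_bot] at hM
  obtain ⟨r, hr⟩ := hM
  exact ⟨r, hr.symm⟩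

lemma mul_ne_zero_of_contractKer_sup_eq_top {M N : ExteriorAlgebra ℝ X} (hM : M ≠ 0)
    (hN : N ≠ 0) (htop : contractKer M ⊔ contractKer N = ⊤) : M * N ≠ 0 := by
  induction hK : contractKer M using WellFoundedGT.induction generalizing M with
  | ind K ih =>
    subst hK
    intro hMN
    by_cases hle : contractKer N ≤ contractKer M
    · obtain ⟨r, rfl⟩ :=
        exists_eq_algebraMap_of_contractKer_eq_top ((sup_eq_left.2 hle).symm.trans htop)
      rw [← Algebra.smul_def, smul_eq_zero] at hMN
      rcases hMN with rfl | h
      · exact hM (map_zero _)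
      · exact hN h
    obtain ⟨ψ, hψN, hψM⟩ := SetLike.not_le_iff_exists.1 hle
    have hsub := contractKer_le_contractKer_contractLeft ψ M
    have hlt : contractKer M < contractKer (contractLeft ψ M) :=
      lt_of_le_of_ne hsub fun h =>
        hψM (h.ge (mem_contractKer.2 (contractLeft_contractLeft (Q := 0) ψ M)))
    refine ih _ hlt hψM (top_le_iff.1 (htop.ge.trans (sup_le_sup_right hsub _))) rfl ?_
    have h := contractLeft_mul ψ M N
    rw [hMN, mem_contractKer.1 hψN, map_zero, mul_zero, add_zero] at h
    exact h.symm

lemma contractKer_mul {M N : ExteriorAlgebra ℝ X} (hM : M ≠ 0) (hN : N ≠ 0)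
    (htop : contractKer M ⊔ contractKer N = ⊤) :
    contractKer (M * N) = contractKer M ⊓ contractKer N := by
  refine le_antisymm (fun φ hφ => ?_) fun φ hφ => ?_
  · obtain ⟨α, hα, β, hβ, rfl⟩ := Submodule.mem_sup.1 (htop.ge (Submodule.mem_top (x := φ)))
    rw [mem_contractKer] at hα hβ hφ
    rw [contractLeft_mul, map_add, LinearMap.add_apply, LinearMap.add_apply, hα, hβ, zero_add,
      add_zero] at hφ
    have key : involute (contractLeft β M) * contractLeft α N = 0 := by
      have h := congrArg (contractLeft β) hφ
      rw [map_add, contractLeft_mul, contractLeft_mul, contractLeft_contractLeft, hβ,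
        contractLeft_comm, hβ, contractLeft_involute] at h
      simpa using h
    have hαN : contractLeft α N = 0 := by
      by_contra hne
      have hβM : contractLeft β M = 0 := by
        by_contra hne'
        refine mul_ne_zero_of_contractKer_sup_eq_top (mt involute_eq_zero_iff.1 hne') hne
          (top_le_iff.1 (htop.ge.trans (sup_le_sup ?_ ?_))) key
        · exact (contractKer_le_contractKer_contractLeft β M).trans
            (contractKer_le_contractKer_involute _)
        · exact contractKer_le_contractKer_contractLeft α N
      rw [hβM, zero_mul, zero_add] at hφ
      exact mul_ne_zero_of_contractKer_sup_eq_top (mt involute_eq_zero_iff.1 hM) hne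
        (top_le_iff.1 (htop.ge.trans (sup_le_sup (contractKer_le_contractKer_involute M)
          (contractKer_le_contractKer_contractLeft α N)))) hφ
    have hβM : contractLeft β M = 0 := by
      by_contra hne
      rw [hαN, mul_zero, add_zero] at hφ
      exact mul_ne_zero_of_contractKer_sup_eq_top hne hN
        (top_le_iff.1 (htop.ge.trans
          (sup_le_sup_right (contractKer_le_contractKer_contractLeft β M) _))) hφ
    exact ⟨add_mem hα hβM, add_mem hαN hβ⟩
  · rw [mem_contractKer, contractLeft_mul, mem_contractKer.1 hφ.1, mem_contractKer.1 hφ.2,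
      zero_mul, mul_zero, add_zero]

lemma contractKer_sup_eq_top {M N : ExteriorAlgebra ℝ X}
    (hdisj : outerSpace M ⊓ outerSpace N = ⊥) : contractKer M ⊔ contractKer N = ⊤ := by
  rw [outerSpace_eq_dualCoannihilator, outerSpace_eq_dualCoannihilator,
    ← Submodule.dualCoannihilator_sup_eq] at hdisj
  rw [← Subspace.dualCoannihilator_dualAnnihilator_eq
    (W := contractKer M ⊔ contractKer N), hdisj, Submodule.dualAnnihilator_bot]

lemma outerSpace_mul {M N : ExteriorAlgebra ℝ X} (hM : M ≠ 0) (hN : N ≠ 0)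
    (hdisj : outerSpace M ⊓ outerSpace N = ⊥) :
    outerSpace (M * N) = outerSpace M ⊔ outerSpace N := by
  simp only [outerSpace_eq_dualCoannihilator]
  rw [contractKer_mul hM hN (contractKer_sup_eq_top hdisj)]
  conv_lhs =>
    rw [← Subspace.dualCoannihilator_dualAnnihilator_eq (W := contractKer M),
      ← Subspace.dualCoannihilator_dualAnnihilator_eq (W := contractKer N),
      ← Submodule.dualAnnihilator_sup_eq, Subspace.dualAnnihilator_dualCoannihilator_eq]

lemma innerSpace_le_outerSpace {M : ExteriorAlgebra ℝ X} (hM : M ≠ 0) :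
    innerSpace M ≤ outerSpace M :=
  (innerSpace_le_dualCoannihilator hM).trans (outerSpace_eq_dualCoannihilator M).ge

lemma innerSpace_mul {M N : ExteriorAlgebra ℝ X} (hM : M ≠ 0) (hN : N ≠ 0)
    (hdisj : outerSpace M ⊓ outerSpace N = ⊥) :
    innerSpace (M * N) = innerSpace M ⊔ innerSpace N := by
  have htop := contractKer_sup_eq_top hdisj
  have hswap (n : X) : ι ℝ n * (M * N) = involute M * (ι ℝ n * N) := by
    rw [← mul_assoc, ι_mul_eq_involute_mul_ι, mul_assoc]
  refine le_antisymm (fun v hv => ?_) (sup_le (fun v hv => ?_) fun v hv => ?_)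
  · have hv' := innerSpace_le_outerSpace (mul_ne_zero_of_contractKer_sup_eq_top hM hN htop) hv
    rw [outerSpace_mul hM hN hdisj, outerSpace_eq_dualCoannihilator,
      outerSpace_eq_dualCoannihilator] at hv'
    obtain ⟨m, hm, n, hn, rfl⟩ := Submodule.mem_sup.1 hv'
    have hm' := contractKer_le_contractKer_ι_mul hm
    have hn' := contractKer_le_contractKer_ι_mul hn
    rw [mem_innerSpace, map_add, add_mul, hswap n, ← mul_assoc] at hv
    have key : involute (ι ℝ m * M) * (ι ℝ n * N) = 0 := by
      have h := congrArg (ι ℝ m * ·) hv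
      simp only [mul_add, mul_zero] at h
      rw [← mul_assoc _ _ N, ← mul_assoc _ _ M, ι_sq_zero, zero_mul, zero_mul, zero_add] at h
      rw [map_mul, involute_ι_eq, neg_mul, neg_mul, mul_assoc, h, neg_zero]
    have hnN : ι ℝ n * N = 0 := by
      by_contra hne
      have hmM : ι ℝ m * M = 0 := by
        by_contra hne'
        exact mul_ne_zero_of_contractKer_sup_eq_top (mt involute_eq_zero_iff.1 hne') hne
          (top_le_iff.1 (htop.ge.trans (sup_le_sup
            (hm'.trans (contractKer_le_contractKer_involute _)) hn'))) key
      rw [hmM, zero_mul, zero_add] at hv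
      exact mul_ne_zero_of_contractKer_sup_eq_top (mt involute_eq_zero_iff.1 hM) hne
        (top_le_iff.1 (htop.ge.trans
          (sup_le_sup (contractKer_le_contractKer_involute M) hn'))) hv
    have hmM : ι ℝ m * M = 0 := by
      by_contra hne
      rw [hnN, mul_zero, add_zero] at hv
      exact mul_ne_zero_of_contractKer_sup_eq_top hne hN
        (top_le_iff.1 (htop.ge.trans (sup_le_sup_right hm' _))) hv
    exact Submodule.add_mem_sup hmM hnN
  · rw [mem_innerSpace, ← mul_assoc, mem_innerSpace.1 hv, zero_mul]
  · rw [mem_innerSpace, hswap, mem_innerSpace.1 hv, mul_zero]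

end ExteriorAlgebra

end

/-- if `osp M ∩ osp N = 0` and `M, N ≠ 0` then `M∧N ≠ 0`,
`osp(M∧N) = osp M ⊕ osp N` and `isp(M∧N) = isp M ⊕ isp N`. -/
theorem stmt14 {X : Type*} [NormedAddCommGroup X] [InnerProductSpace ℝ X]
    [FiniteDimensional ℝ X]
    (M N : ExteriorAlgebra ℝ X) (hM : M ≠ 0) (hN : N ≠ 0)
    (hdisj : outerSpace M ⊓ outerSpace N = ⊥) :
    M * N ≠ 0 ∧
    outerSpace (M * N) = outerSpace M ⊔ outerSpace N ∧
    innerSpace (M * N) = innerSpace M ⊔ innerSpace N ∧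
    innerSpace M ⊓ innerSpace N = ⊥ := by
  have htop := ExteriorAlgebra.contractKer_sup_eq_top hdisj
  refine ⟨ExteriorAlgebra.mul_ne_zero_of_contractKer_sup_eq_top hM hN htop,
    ExteriorAlgebra.outerSpace_mul hM hN hdisj, ExteriorAlgebra.innerSpace_mul hM hN hdisj, ?_⟩
  exact le_bot_iff.1 (hdisj.le.trans' (inf_le_inf
    (ExteriorAlgebra.innerSpace_le_outerSpace hM) (ExteriorAlgebra.innerSpace_le_outerSpace hN)))
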